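/- Let C⊥ ⊆ F₂²³ be the binary Golay code specified in the context. Then every nonzero codeword of C⊥ has Hamming weight at least 7, and there exists a codeword of C⊥ of Hamming weight exactly 7; i.e., the minimum distance of C⊥ is 7 (so the associated [[23,1,7]] quantum Golay code has distance 7). -/

import Mathlib

def golaySupports : Fin 11 → Finset (Fin 23) :=
  ![{1,4,7,8,9,10,11,22}, {0,3,6,7,8,9,10,21}, {1,2,4,5,6,10,11,20},
    {0,1,3,4,5,9,10,19}, {0,1,2,3,7,10,11,18}, {0,2,4,6,7,8,11,17},
    {3,4,5,6,8,9,11,16}, {2,3,4,5,7,8,10,15}, {1,2,3,4,6,7,9,14},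
    {0,1,2,3,5,6,8,13}, {0,2,5,8,9,10,11,12}]

def golayGen (i : Fin 11) : Fin 23 → ZMod 2 := fun j => if j ∈ golaySupports i then 1 else 0

def golayC : Submodule (ZMod 2) (Fin 23 → ZMod 2) :=
  Submodule.span (ZMod 2) (Set.range golayGen)

def golayDual : Submodule (ZMod 2) (Fin 23 → ZMod 2) where
  carrier := {u | ∀ w ∈ golayC, ∑ i, u i * w i = 0}
  zero_mem' := by intro w _; simp
  add_mem' := by
    intro u v hu hv w hw
    simp only [Set.mem_setOf_eq] at hu hv ⊢
    simp only [Pi.add_apply, add_mul, Finset.sum_add_distrib, hu w hw, hv w hw, add_zero]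
  smul_mem' := by
    intro c u hu w hw
    simp only [Set.mem_setOf_eq] at hu ⊢
    simp only [Pi.smul_apply, smul_eq_mul, mul_assoc, ← Finset.mul_sum, hu w hw, mul_zero]

/-- The systematic encoder of the dual code: the first twelve coordinates are free, and
coordinate `22 - i` is the parity of the free coordinates in the support of generator `i`. -/
def golayEncode (a b c d e f g h i j k l : ZMod 2) : Fin 23 → ZMod 2 :=
  ![a, b, c, d, e, f, g, h, i, j, k, l,
    a + c + f + i + j + k + l,
    a + b + c + d + f + g + i,
    b + c + d + e + g + h + j,
    c + d + e + f + h + i + k,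
    d + e + f + g + i + j + l,
    a + c + e + g + h + i + l,
    a + b + c + d + h + k + l,
    a + b + d + e + f + j + k,
    b + c + e + f + g + k + l,
    a + d + g + h + i + j + k,
    b + e + h + i + j + k + l]

/-- The Hamming weight of the encoding of a word of bits, written as natural numbers. -/
def golayEncodeWeight (a b c d e f g h i j k l : ℕ) : ℕ :=
  a + b + c + d + e + f + g + h + i + j + k + l +
    (a + c + f + i + j + k + l) % 2 + (a + b + c + d + f + g + i) % 2 +
    (b + c + d + e + g + h + j) % 2 + (c + d + e + f + h + i + k) % 2 +
    (d + e + f + g + i + j + l) % 2 + (a + c + e + g + h + i + l) % 2 +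
    (a + b + c + d + h + k + l) % 2 + (a + b + d + e + f + j + k) % 2 +
    (b + c + e + f + g + k + l) % 2 + (a + d + g + h + i + j + k) % 2 +
    (b + e + h + i + j + k + l) % 2

theorem golayEncodeWeight_eq_zero_or_seven_le : ∀ a b c d e f g h i j k l : Fin 2,
    golayEncodeWeight a b c d e f g h i j k l = 0 ∨
      7 ≤ golayEncodeWeight a b c d e f g h i j k l := by
  decide +kernel

theorem hammingNorm_eq_sum_val {ι : Type*} [Fintype ι] (u : ι → ZMod 2) :
    hammingNorm u = ∑ j, (u j).val := by
  have ite_eq_val : ∀ x : ZMod 2, (if x ≠ 0 then 1 else 0) = x.val := by decide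
  simp only [hammingNorm, Finset.card_filter, ite_eq_val]

theorem hammingNorm_golayEncode (a b c d e f g h i j k l : ZMod 2) :
    hammingNorm (golayEncode a b c d e f g h i j k l) =
      golayEncodeWeight a.val b.val c.val d.val e.val f.val
        g.val h.val i.val j.val k.val l.val := by
  simp [hammingNorm_eq_sum_val, golayEncode, golayEncodeWeight, Fin.sum_univ_succ, ZMod.val_add,
    add_assoc]

theorem hammingNorm_golayEncode_eq_zero_or_seven_le (a b c d e f g h i j k l : ZMod 2) :
    hammingNorm (golayEncode a b c d e f g h i j k l) = 0 ∨
      7 ≤ hammingNorm (golayEncode a b c d e f g h i j k l) := by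
  rw [hammingNorm_golayEncode]
  exact golayEncodeWeight_eq_zero_or_seven_le a b c d e f g h i j k l

theorem mem_golayDual_iff {u : Fin 23 → ZMod 2} :
    u ∈ golayDual ↔ ∀ i, ∑ j ∈ golaySupports i, u j = 0 := by
  have sum_mul_golayGen (i : Fin 11) :
      ∑ j, u j * golayGen i j = ∑ j ∈ golaySupports i, u j := by
    simp [golayGen]
  constructor
  · intro hu i
    rw [← sum_mul_golayGen]
    exact hu _ (Submodule.subset_span ⟨i, rfl⟩)
  · intro hu w hw
    induction hw using Submodule.span_induction with
    | mem w hw =>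
      obtain ⟨i, rfl⟩ := hw
      rw [sum_mul_golayGen, hu]
    | zero => simp
    | add x y _ _ hx hy => simp [mul_add, Finset.sum_add_distrib, hx, hy]
    | smul c x _ hx => simp [mul_left_comm _ c, ← Finset.mul_sum, hx]

theorem eq_golayEncode_of_mem_golayDual {u : Fin 23 → ZMod 2} (hu : u ∈ golayDual) :
    u = golayEncode (u 0) (u 1) (u 2) (u 3) (u 4) (u 5) (u 6) (u 7) (u 8) (u 9) (u 10) (u 11) := by
  rw [mem_golayDual_iff] at hu
  simp only [Fin.forall_fin_succ, golaySupports] at hu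
  simp [Finset.sum_insert, ← add_assoc, CharTwo.add_eq_zero] at hu
  ext j
  fin_cases j <;> simp [golayEncode, hu]

theorem stmt_13 :
    (∀ u ∈ golayDual, u ≠ 0 → 7 ≤ hammingNorm u) ∧
    (∃ u ∈ golayDual, hammingNorm u = 7) := by
  refine ⟨fun u hu hu0 => ?_, golayEncode 1 0 0 0 0 0 0 0 0 0 0 0, ?_, ?_⟩
  · rw [← hammingNorm_ne_zero_iff, eq_golayEncode_of_mem_golayDual hu] at hu0
    rw [eq_golayEncode_of_mem_golayDual hu]
    exact (hammingNorm_golayEncode_eq_zero_or_seven_le ..).resolve_left hu0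
  · rw [mem_golayDual_iff]
    decide +kernel
  · decide +kernel
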